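/- arXiv:1608.04578 — 2 statements merged into one kernel-verified Lean document; each statement's English description precedes it below -/
import Mathlib

section
/- Let d ≥ 3 and let (S⁽¹⁾_n, …, S⁽ᵈ⁾_n) be the simple random walk on ℤ^d. The process (|S⁽¹⁾_n|, S⁽²⁾_n, …, S⁽ᵈ⁾_n) has the same law as the random walk on the half lattice H = {x ∈ ℤ^d : x₁ ≥ 0} with conductances c(x,y) = 1/2 when x₁ = y₁ = 0 and c(x,y) = 1 otherwise, and its Green's function equals g(x, y) + g(x, ȳ) for all x, y ∈ H, where ȳ = (−y₁, y₂, …, y_d) and g is the Green's function of the simple random walk on ℤ^d. -/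
open scoped ENNReal
open Filter

noncomputable section

variable {V : Type*}

/-- Total conductance (weight) `π(x) = Σ_y c(x,y)` at a vertex `x`. -/
def piW (c : V → V → ℝ≥0∞) (x : V) : ℝ≥0∞ := ∑' y, c x y

/-- One-step transition probability `c(x,y)/π(x)` of the random walk with conductances `c`. -/
def step (c : V → V → ℝ≥0∞) (x y : V) : ℝ≥0∞ := c x y / piW c x

/-- `n`-step transition probability of the random walk with conductances `c`. -/
def stepN [DecidableEq V] (c : V → V → ℝ≥0∞) : ℕ → V → V → ℝ≥0∞
  | 0, x, y => if x = y then 1 else 0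
  | n + 1, x, y => ∑' z, stepN c n x z * step c z y

/-- Green's function `G(x,y) = π(y)⁻¹ Σ_n p_n(x,y)` of the walk with conductances `c`. -/
def green [DecidableEq V] (c : V → V → ℝ≥0∞) (x y : V) : ℝ≥0∞ :=
  (piW c y)⁻¹ * ∑' n, stepN c n x y

/-- Nearest-neighbour adjacency on `ℤ^d`. -/
def latAdj {d : ℕ} (x y : Fin d → ℤ) : Prop := (∑ i, (x i - y i).natAbs) = 1

instance {d : ℕ} (x y : Fin d → ℤ) : Decidable (latAdj x y) := by
  unfold latAdj; infer_instance

/-- Unit conductances on `ℤ^d`. -/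
def cZ (d : ℕ) (x y : Fin d → ℤ) : ℝ≥0∞ := if latAdj x y then 1 else 0

/-- Green's function of the simple random walk on `ℤ^d`. -/
def g (d : ℕ) : (Fin d → ℤ) → (Fin d → ℤ) → ℝ≥0∞ := green (cZ d)

/-- Membership in `U_m = ℕ₀^m × ℤ^{d-m}`: the first `m` coordinates are nonnegative. -/
def memU (m : ℕ) {d : ℕ} (x : Fin d → ℤ) : Prop := ∀ i : Fin d, (i : ℕ) < m → 0 ≤ x i

instance (m : ℕ) {d : ℕ} (x : Fin d → ℤ) : Decidable (memU m x) := by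
  unfold memU; infer_instance

/-- Unit conductances on the subgraph `U_m` of `ℤ^d`. -/
def cU (d m : ℕ) (x y : Fin d → ℤ) : ℝ≥0∞ :=
  if memU m x ∧ memU m y ∧ latAdj x y then 1 else 0

/-- Green's function `G_m` of the simple random walk on `U_m = ℕ₀^m × ℤ^{d-m}`. -/
def Gm (d m : ℕ) : (Fin d → ℤ) → (Fin d → ℤ) → ℝ≥0∞ := green (cU d m)

/-- Reflection in the first coordinate: `ȳ = (-y₁, y₂, …, y_d)`. -/
def reflFirst {d : ℕ} (y : Fin d → ℤ) : Fin d → ℤ := fun i => if (i : ℕ) = 0 then -y i else y i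

/-- The first standard basis vector of `ℤ^d`. -/
def e1 (d : ℕ) : Fin d → ℤ := fun i => if (i : ℕ) = 0 then 1 else 0


/-- Probability of a finite path `w = (w_0, …, w_n)` under the walk with conductances `c`. -/
def pathProb (c : V → V → ℝ≥0∞) {n : ℕ} (w : Fin (n + 1) → V) : ℝ≥0∞ :=
  ∏ i : Fin n, step c (w i.castSucc) (w i.succ)

/-- Folding map `z ↦ (|z₁|, z₂, …, z_d)`. -/
def fold1 {d : ℕ} (z : Fin d → ℤ) : Fin d → ℤ := fun i => if (i : ℕ) = 0 then |z i| else z i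

/-- Conductances on the half lattice `H = U_1` equal to `1/2` on edges both of whose
endpoints have vanishing first coordinate, and `1` on all other edges of `H`. -/
def cHalfRefl (d : ℕ) (x y : Fin d → ℤ) : ℝ≥0∞ :=
  if memU 1 x ∧ memU 1 y ∧ latAdj x y then
    (if ∀ i : Fin d, (i : ℕ) = 0 → (x i = 0 ∧ y i = 0) then 1 / 2 else 1)
  else 0

section Lumping

variable {W : Type*} [DecidableEq W]

/-- If the conductances of the fibres of `f` are those of `c'` up to a factor depending only on
the starting point, the total conductances differ by the same factor. -/
theorem piW_of_fibre_sum {c : V → V → ℝ≥0∞} {c' : W → W → ℝ≥0∞} {f : V → W} {κ : W → ℝ≥0∞}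
    (h : ∀ z b, ∑' z', (if f z' = b then c z z' else 0) = κ (f z) * c' (f z) b) (z : V) :
    piW c z = κ (f z) * piW c' (f z) := by
  simp only [piW, ← ENNReal.tsum_mul_left, ← h]
  rw [ENNReal.tsum_comm]
  simp

theorem step_of_fibre_sum {c : V → V → ℝ≥0∞} {c' : W → W → ℝ≥0∞} {f : V → W} {κ : W → ℝ≥0∞}
    (h : ∀ z b, ∑' z', (if f z' = b then c z z' else 0) = κ (f z) * c' (f z) b)
    (h0 : ∀ b, κ b ≠ 0) (ht : ∀ b, κ b ≠ ⊤) (z : V) (b : W) :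
    ∑' z', (if f z' = b then step c z z' else 0) = step c' (f z) b := by
  have : ∀ z', (if f z' = b then step c z z' else 0)
      = (if f z' = b then c z z' else 0) * (piW c z)⁻¹ := by
    intro z'
    split_ifs <;> simp [step, div_eq_mul_inv]
  simp only [this, ENNReal.tsum_mul_right, h, piW_of_fibre_sum h]
  rw [← div_eq_mul_inv, ENNReal.mul_div_mul_left _ _ (h0 _) (ht _), step]

theorem stepN_of_step_fibre_sum [DecidableEq V] {c : V → V → ℝ≥0∞} {c' : W → W → ℝ≥0∞} {f : V → W}
    (h : ∀ z b, ∑' z', (if f z' = b then step c z z' else 0) = step c' (f z) b)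
    (n : ℕ) (x : V) (b : W) :
    stepN c' n (f x) b = ∑' z, (if f z = b then stepN c n x z else 0) := by
  induction n generalizing b with
  | zero =>
    simp only [stepN]
    rw [tsum_eq_single x (by intro z hz; simp [hz.symm])]
    simp
  | succ n ih =>
    have h1 : ∀ w, stepN c' n (f x) w * step c' w b
        = ∑' z, (if w = f z then stepN c n x z * step c' (f z) b else 0) := by
      intro w
      rw [ih, ← ENNReal.tsum_mul_right]
      refine tsum_congr fun z => ?_
      by_cases hz : f z = w
      · simp [hz]
      · simp [hz, Ne.symm hz]
    have h2 : ∀ z', (if f z' = b then stepN c (n + 1) x z' else 0)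
        = ∑' z, stepN c n x z * (if f z' = b then step c z z' else 0) := by
      intro z'
      split_ifs <;> simp [stepN]
    simp only [stepN, h1]
    rw [ENNReal.tsum_comm]
    simp only [tsum_ite_eq, ← h, ← ENNReal.tsum_mul_left]
    rw [ENNReal.tsum_comm]
    exact tsum_congr fun z' => (h2 z').symm

theorem pathProb_succ (c : V → V → ℝ≥0∞) {n : ℕ} (w : Fin (n + 2) → V) :
    pathProb c w = step c (w 0) (w 1) * pathProb c (Fin.tail w) := by
  simp only [pathProb, Fin.prod_univ_succ]
  rfl

open Classical in
theorem pathProb_of_step_fibre_sum {c : V → V → ℝ≥0∞} {c' : W → W → ℝ≥0∞} {f : V → W}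
    (h : ∀ z b, ∑' z', (if f z' = b then step c z z' else 0) = step c' (f z) b)
    (n : ℕ) (x : V) (w : Fin (n + 1) → W) (hw : w 0 = f x) :
    ∑' z : Fin (n + 1) → V, (if z 0 = x ∧ ∀ k, f (z k) = w k then pathProb c z else 0)
      = pathProb c' w := by
  induction n generalizing x with
  | zero =>
    rw [tsum_eq_single (fun _ => x)]
    · simp [pathProb, hw, Fin.forall_fin_one]
    · intro z hz
      refine if_neg fun hx => hz (funext fun k => ?_)
      rw [Fin.fin_one_eq_zero k, hx.1]
  | succ n ih =>
    have inner : ∀ z : Fin (n + 1) → V,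
        ∑' a, (if a = x ∧ ∀ k, f ((Fin.cons a z : Fin (n + 2) → V) k) = w k
            then pathProb c (Fin.cons a z : Fin (n + 2) → V) else 0)
          = ∑' y, (if f y = w 1 then step c x y else 0) *
              (if z 0 = y ∧ ∀ k, f (z k) = Fin.tail w k then pathProb c z else 0) := by
      intro z
      rw [tsum_eq_single x (by intro a ha; simp [ha]),
        tsum_eq_single (z 0) (by intro y hy; simp [hy.symm])]
      have hz : (∀ k, f ((Fin.cons x z : Fin (n + 2) → V) k) = w k)
          ↔ ∀ k, f (z k) = Fin.tail w k := by
        rw [Fin.forall_fin_succ]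
        simp [hw, Fin.tail]
      by_cases hk : ∀ k, f (z k) = Fin.tail w k
      · have h0 : f (z 0) = w 1 := hk 0
        have hx := hz.2 hk
        rw [if_pos ⟨rfl, hx⟩, if_pos h0, if_pos ⟨rfl, hk⟩, pathProb_succ]
        rfl
      · rw [if_neg (fun hx => hk (hz.1 hx.2)),
          if_neg (c := z 0 = z 0 ∧ _) (fun hx => hk hx.2), mul_zero]
    rw [← (Fin.consEquiv fun _ => V).tsum_eq, ENNReal.tsum_prod', ENNReal.tsum_comm]
    simp only [Fin.consEquiv, Equiv.coe_fn_mk, Fin.cons_zero]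
    rw [tsum_congr inner, ENNReal.tsum_comm]
    simp only [ENNReal.tsum_mul_left]
    rw [pathProb_succ, hw, ← h, ← ENNReal.tsum_mul_right]
    refine tsum_congr fun y => ?_
    by_cases hy : f y = w 1
    · rw [ih y (Fin.tail w) hy.symm]
    · simp [hy]

end Lumping

section Folding

variable {e : ℕ}

theorem memU_one_iff {x : Fin (e + 1) → ℤ} : memU 1 x ↔ 0 ≤ x 0 :=
  ⟨fun h => h 0 (by simp), fun h i hi => by
    obtain rfl : i = 0 := Fin.ext (by simpa using hi)
    exact h⟩

@[simp] theorem fold1_zero (x : Fin (e + 1) → ℤ) : fold1 x 0 = |x 0| := by simp [fold1]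

@[simp] theorem fold1_succ (x : Fin (e + 1) → ℤ) (i : Fin e) : fold1 x i.succ = x i.succ := by
  simp [fold1]

@[simp] theorem reflFirst_zero (x : Fin (e + 1) → ℤ) : reflFirst x 0 = -x 0 := by
  simp [reflFirst]

@[simp] theorem reflFirst_succ (x : Fin (e + 1) → ℤ) (i : Fin e) :
    reflFirst x i.succ = x i.succ := by
  simp [reflFirst]

theorem latAdj_iff_succ {x y : Fin (e + 1) → ℤ} :
    latAdj x y ↔ (x 0 - y 0).natAbs + ∑ i : Fin e, (x i.succ - y i.succ).natAbs = 1 := by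
  rw [latAdj, Fin.sum_univ_succ]

theorem fold1_of_memU {x : Fin (e + 1) → ℤ} (hx : memU 1 x) : fold1 x = x := by
  ext i
  refine Fin.cases ?_ (fun i => ?_) i
  · simpa using memU_one_iff.1 hx
  · simp

theorem memU_fold1 (x : Fin (e + 1) → ℤ) : memU 1 (fold1 x) := by
  simp [memU_one_iff]

theorem reflFirst_eq_self_iff {x : Fin (e + 1) → ℤ} : reflFirst x = x ↔ x 0 = 0 := by
  rw [funext_iff, Fin.forall_fin_succ]
  simp only [reflFirst_zero, reflFirst_succ, implies_true, and_true]
  omega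

theorem fold1_reflFirst (x : Fin (e + 1) → ℤ) : fold1 (reflFirst x) = fold1 x := by
  rw [funext_iff, Fin.forall_fin_succ]
  simp

theorem fold1_eq_iff {z b : Fin (e + 1) → ℤ} (hb : memU 1 b) :
    fold1 z = b ↔ z = b ∨ z = reflFirst b := by
  have h0 := memU_one_iff.1 hb
  simp only [funext_iff, Fin.forall_fin_succ, fold1_zero, fold1_succ, reflFirst_zero,
    reflFirst_succ, ← or_and_right, abs_eq h0]

/-- Sum over a fibre of the folding map. -/
theorem tsum_fold1_fibre {b : Fin (e + 1) → ℤ} (hb : memU 1 b) (F : (Fin (e + 1) → ℤ) → ℝ≥0∞) :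
    ∑' z, (if fold1 z = b then F z else 0)
      = if b 0 = 0 then F b else F b + F (reflFirst b) := by
  simp only [fold1_eq_iff hb]
  split_ifs with h0
  · simp [reflFirst_eq_self_iff.2 h0]
  · have hne : reflFirst b ≠ b := fun h => h0 (reflFirst_eq_self_iff.1 h)
    have : ∀ z, (if z = b ∨ z = reflFirst b then F z else 0)
        = (if z = b then F b else 0) + (if z = reflFirst b then F (reflFirst b) else 0) := by
      intro z
      by_cases h1 : z = b
      · subst h1
        simp [hne.symm]
      · by_cases h2 : z = reflFirst b
        · subst h2
          simp [hne]
        · simp [h1, h2]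
    simp only [this, ENNReal.tsum_add, tsum_ite_eq]

theorem cHalfRefl_of_memU {a b : Fin (e + 1) → ℤ} (ha : memU 1 a) (hb : memU 1 b) :
    cHalfRefl (e + 1) a b
      = if latAdj a b then (if a 0 = 0 ∧ b 0 = 0 then 1 / 2 else 1) else 0 := by
  have : (∀ i : Fin (e + 1), (i : ℕ) = 0 → (a i = 0 ∧ b i = 0)) ↔ (a 0 = 0 ∧ b 0 = 0) :=
    ⟨fun h => h 0 rfl, fun h i hi => by
      obtain rfl : i = 0 := Fin.ext hi
      exact h⟩
  simp only [cHalfRefl, ha, hb, true_and, this]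

/-- Ratio of the conductances of the lattice edges to those of the folded edges. -/
def foldFactor (a : Fin (e + 1) → ℤ) : ℝ≥0∞ := if a 0 = 0 then 2 else 1

theorem foldFactor_ne_zero (a : Fin (e + 1) → ℤ) : foldFactor a ≠ 0 := by
  unfold foldFactor; split_ifs <;> simp

theorem foldFactor_ne_top (a : Fin (e + 1) → ℤ) : foldFactor a ≠ ⊤ := by
  unfold foldFactor; split_ifs <;> simp

theorem cZ_fibre_sum (z b : Fin (e + 1) → ℤ) :
    ∑' z', (if fold1 z' = b then cZ (e + 1) z z' else 0)
      = foldFactor (fold1 z) * cHalfRefl (e + 1) (fold1 z) b := by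
  by_cases hb : memU 1 b
  · rw [tsum_fold1_fibre hb, cHalfRefl_of_memU (memU_fold1 z) hb]
    have h0 := memU_one_iff.1 hb
    simp only [cZ, foldFactor, latAdj_iff_succ, fold1_zero, fold1_succ, reflFirst_zero,
      reflFirst_succ, abs_eq_zero]
    generalize ∑ i : Fin e, (z i.succ - b i.succ).natAbs = T
    by_cases hb0 : b 0 = 0
    · have : (|z 0| - b 0).natAbs = (z 0 - b 0).natAbs := by simp [hb0, Int.natAbs_abs]
      rw [this]
      by_cases hz0 : z 0 = 0
      · simp [hb0, hz0, ENNReal.mul_inv_cancel]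
      · simp [hb0, hz0]
    · rcases lt_trichotomy (z 0) 0 with hz | hz | hz
      · have h1 : ¬ ((z 0 - b 0).natAbs + T = 1) := by omega
        have h2 : (|z 0| - b 0).natAbs = (z 0 - -b 0).natAbs := by
          rw [abs_of_neg hz]; omega
        simp only [hb0, hz.ne, h1, h2, if_false, and_false, zero_add, one_mul]
      · have h2 : (0 - -b 0).natAbs = (0 - b 0).natAbs := by omega
        simp only [hz, h2, hb0, if_false, if_true, and_false, abs_zero]
        split_ifs <;> norm_num
      · have h1 : ¬ ((z 0 - -b 0).natAbs + T = 1) := by omega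
        simp only [abs_of_pos hz, hb0, hz.ne', h1, if_false, and_false, add_zero, one_mul]
  · have hne : ∀ z' : Fin (e + 1) → ℤ, fold1 z' ≠ b := fun z' h => hb (h ▸ memU_fold1 z')
    simp [hne, cHalfRefl, hb]

end Folding

/-- For `d ≥ 3` and a starting point `x` in the half lattice `H`:
(1) the process `(|S⁽¹⁾_n|, S⁽²⁾_n, …, S⁽ᵈ⁾_n)`, image of the simple random walk on `ℤ^d`
under the folding map, has the same law (i.e. the same finite-dimensional path
probabilities) as the random walk on `H` with conductances `1/2` on the boundary edges
(`x₁ = y₁ = 0`) and `1` otherwise; and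
(2) the Green's function of the latter walk equals `g(x,y) + g(x,ȳ)` for `y ∈ H`. -/
theorem folded_walk_law_and_green (d : ℕ) (hd : 3 ≤ d) (x : Fin d → ℤ) (hx : memU 1 x) :
    (∀ n : ℕ, ∀ w : Fin (n + 1) → (Fin d → ℤ), w 0 = x → (∀ k, memU 1 (w k)) →
      (∑' z : {z : Fin (n + 1) → (Fin d → ℤ) // z 0 = x ∧ ∀ k, fold1 (z k) = w k},
        pathProb (cZ d) z.1) = pathProb (cHalfRefl d) w) ∧
    (∀ y : Fin d → ℤ, memU 1 y →
      green (cHalfRefl d) x y = g d x y + g d x (reflFirst y)) := by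
  obtain ⟨e, rfl⟩ : ∃ e, d = e + 1 := ⟨d - 1, by omega⟩
  have hstep := step_of_fibre_sum (cZ_fibre_sum (e := e)) foldFactor_ne_zero foldFactor_ne_top
  constructor
  · intro n w hw0 _
    classical
    have hpath := pathProb_of_step_fibre_sum hstep n x w (by rw [hw0, fold1_of_memU hx])
    rw [← hpath]
    refine (tsum_subtype {z : Fin (n + 1) → Fin (e + 1) → ℤ | z 0 = x ∧ ∀ k, fold1 (z k) = w k}
      (fun z => pathProb (cZ (e + 1)) z)).trans (tsum_congr fun z => ?_)
    simp [Set.indicator_apply]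
  · intro y hy
    have hN : ∀ n, stepN (cHalfRefl (e + 1)) n x y = if y 0 = 0 then stepN (cZ (e + 1)) n x y
        else stepN (cZ (e + 1)) n x y + stepN (cZ (e + 1)) n x (reflFirst y) := by
      intro n
      rw [← tsum_fold1_fibre hy, ← stepN_of_step_fibre_sum hstep, fold1_of_memU hx]
    have hpi := piW_of_fibre_sum (cZ_fibre_sum (e := e)) y
    have hpi' := piW_of_fibre_sum (cZ_fibre_sum (e := e)) (reflFirst y)
    rw [fold1_reflFirst] at hpi'
    rw [fold1_of_memU hy] at hpi hpi'
    simp only [g, green, hpi, hpi', hN]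
    rw [ENNReal.mul_inv (Or.inl (foldFactor_ne_zero y)) (Or.inl (foldFactor_ne_top y))]
    by_cases hy0 : y 0 = 0
    · simp only [hy0, if_true, foldFactor, reflFirst_eq_self_iff.2 hy0]
      rw [← add_mul, ← add_mul, ENNReal.inv_two_add_inv_two, one_mul]
    · simp only [hy0, if_false, foldFactor, inv_one, one_mul, ENNReal.tsum_add, mul_add]

end
end

section
/- Let d ≥ 4 and L ∈ {2, 3, …}. For all x, y in the strip S_L = [0, L−1] × ℤ^{d−1} (with nearest-neighbor edges and unit conductances), the Green's function of the simple random walk on S_L satisfies G_{S_L}(x, y) = Σ_{k=−∞}^{+∞} [ g(x, (kL + L − 1)e₁ + ȳ) · 1{k odd} + g(x, kL e₁ + y) · 1{k even} ], where ȳ = (−y₁, y₂, …, y_d), e₁ is the first standard basis vector, and g is the Green's function of the simple random walk on ℤ^d. -/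
open scoped ENNReal
open Filter

noncomputable section

variable {V : Type*}

/-- Membership in the strip `S_L = [0, L-1] × ℤ^{d-1}`. -/
def memS (L : ℕ) {d : ℕ} (x : Fin d → ℤ) : Prop :=
  ∀ i : Fin d, (i : ℕ) = 0 → (0 ≤ x i ∧ x i ≤ (L : ℤ) - 1)

instance (L : ℕ) {d : ℕ} (x : Fin d → ℤ) : Decidable (memS L x) := by
  unfold memS; infer_instance

/-- Unit conductances on the strip `S_L`. -/
def cS (d L : ℕ) (x y : Fin d → ℤ) : ℝ≥0∞ :=
  if memS L x ∧ memS L y ∧ latAdj x y then 1 else 0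

/-- Green's function of the simple random walk on the strip `S_L`. -/
def GS (d L : ℕ) : (Fin d → ℤ) → (Fin d → ℤ) → ℝ≥0∞ := green (cS d L)

/-! ### Green's functions as minimal supersolutions -/

/-- Green's function of the walk stopped before time `N`. -/
def truncGreen [DecidableEq V] (c : V → V → ℝ≥0∞) (N : ℕ) (x y : V) : ℝ≥0∞ :=
  (piW c y)⁻¹ * ∑ n ∈ Finset.range N, stepN c n x y

lemma stepN_succ_eq [DecidableEq V] (c : V → V → ℝ≥0∞) (n : ℕ) (x y : V) :
    stepN c (n + 1) x y = ∑' z, (piW c z)⁻¹ * stepN c n x z * c z y := by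
  simp only [stepN, step, div_eq_mul_inv]
  exact tsum_congr fun z => by ring

lemma piW_mul_green [DecidableEq V] (c : V → V → ℝ≥0∞) (x y : V) (h0 : piW c y ≠ 0)
    (h1 : piW c y ≠ ∞) :
    piW c y * green c x y = (if x = y then 1 else 0) + ∑' z, green c x z * c z y := by
  rw [green, ← mul_assoc, ENNReal.mul_inv_cancel h0 h1, one_mul, tsum_eq_zero_add' (by simp)]
  simp only [stepN_succ_eq, green]
  rw [ENNReal.tsum_comm]
  simp only [ENNReal.tsum_mul_left, ENNReal.tsum_mul_right, stepN]

lemma piW_mul_truncGreen_succ [DecidableEq V] (c : V → V → ℝ≥0∞) (N : ℕ) (x y : V)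
    (h0 : piW c y ≠ 0) (h1 : piW c y ≠ ∞) :
    piW c y * truncGreen c (N + 1) x y =
      (if x = y then 1 else 0) + ∑' z, truncGreen c N x z * c z y := by
  rw [truncGreen, ← mul_assoc, ENNReal.mul_inv_cancel h0 h1, one_mul, Finset.sum_range_succ',
    add_comm]
  simp only [stepN_succ_eq, truncGreen]
  rw [← Summable.tsum_finsetSum fun _ _ => ENNReal.summable]
  simp only [Finset.mul_sum, Finset.sum_mul, stepN]

@[simp] lemma truncGreen_zero [DecidableEq V] (c : V → V → ℝ≥0∞) (x y : V) :
    truncGreen c 0 x y = 0 := by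
  simp [truncGreen]

lemma green_le_of_truncGreen_le [DecidableEq V] {c : V → V → ℝ≥0∞} {x y : V} {b : ℝ≥0∞}
    (h : ∀ N, truncGreen c N x y ≤ b) : green c x y ≤ b := by
  rw [green, ← ENNReal.tsum_mul_left]
  refine ENNReal.tsum_le_of_sum_range_le fun N => ?_
  rw [← Finset.mul_sum]
  exact h N

lemma green_le_of_supersolution [DecidableEq V] {c : V → V → ℝ≥0∞} {x : V} {A : V → Prop}
    (hA : ∀ z y, A y → c z y ≠ 0 → A z) (h0 : ∀ y, A y → piW c y ≠ 0)
    (h1 : ∀ y, A y → piW c y ≠ ∞) {h : V → ℝ≥0∞}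
    (hh : ∀ y, A y → (if x = y then 1 else 0) + ∑' z, h z * c z y ≤ piW c y * h y)
    {y : V} (hy : A y) : green c x y ≤ h y := by
  refine green_le_of_truncGreen_le fun N => ?_
  induction N generalizing y with
  | zero => simp
  | succ N ih =>
    rw [← ENNReal.mul_le_mul_iff_right (h0 y hy) (h1 y hy),
      piW_mul_truncGreen_succ c N x y (h0 y hy) (h1 y hy)]
    refine le_trans ?_ (hh y hy)
    refine add_le_add le_rfl (ENNReal.tsum_le_tsum fun z => ?_)
    by_cases hz : c z y = 0
    · simp [hz]
    · gcongr
      exact ih (hA z y hy hz)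

/-! ### The reflection group of the strip -/

/-- The element of the reflection group of the strip `S_L` mapping it to its `k`-th copy. -/
def stripImage {d : ℕ} (L : ℕ) (k : ℤ) (y : Fin d → ℤ) : Fin d → ℤ :=
  if k % 2 = 0 then (k * (L : ℤ)) • e1 d + y
  else (k * (L : ℤ) + (L : ℤ) - 1) • e1 d + reflFirst y

lemma stripImage_apply {d : ℕ} (L : ℕ) (k : ℤ) (y : Fin d → ℤ) (i : Fin d) :
    stripImage L k y i = if (i : ℕ) = 0 then
      (if k % 2 = 0 then k * L + y i else k * L + L - 1 - y i) else y i := by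
  unfold stripImage
  split_ifs <;> simp [e1, reflFirst, *]
  ring

lemma stripImage_zero {d : ℕ} (L : ℕ) (y : Fin d → ℤ) : stripImage L 0 y = y := by
  ext i; simp [stripImage_apply]

/-- `stripImage` as a permutation of `ℤ^d`. -/
def stripImageEquiv {d : ℕ} (L : ℕ) (k : ℤ) : Equiv.Perm (Fin d → ℤ) where
  toFun := stripImage L k
  invFun := stripImage L (if k % 2 = 0 then -k else k)
  left_inv y := by
    ext i; simp only [stripImage_apply]; split_ifs <;> first | omega | ring
  right_inv y := by
    ext i; simp only [stripImage_apply]; split_ifs <;> first | omega | ring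

lemma cZ_stripImage {d : ℕ} (L : ℕ) (k : ℤ) (z y : Fin d → ℤ) :
    cZ d (stripImage L k z) (stripImage L k y) = cZ d z y := by
  have : latAdj (stripImage L k z) (stripImage L k y) ↔ latAdj z y := by
    unfold latAdj
    rw [Finset.sum_congr rfl fun i _ => ?_]
    simp only [stripImage_apply]
    split_ifs <;> omega
  simp only [cZ, this]

lemma cZ_comm {d : ℕ} (x y : Fin d → ℤ) : cZ d x y = cZ d y x := by
  have : latAdj x y ↔ latAdj y x := by
    unfold latAdj
    rw [Finset.sum_congr rfl fun i _ => ?_]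
    omega
  simp only [cZ, this]

lemma cS_comm {d L : ℕ} (x y : Fin d → ℤ) : cS d L x y = cS d L y x := by
  have := cZ_comm x y
  simp only [cZ] at this
  unfold cS
  by_cases h1 : memS L x <;> by_cases h2 : memS L y <;> simp [h1, h2, this]

lemma piW_cZ_stripImage {d : ℕ} (L : ℕ) (k : ℤ) (y : Fin d → ℤ) :
    piW (cZ d) (stripImage L k y) = piW (cZ d) y := by
  unfold piW
  rw [← (stripImageEquiv L k).tsum_eq]
  exact tsum_congr fun z => cZ_stripImage L k y z

lemma latAdj_add_single {d : ℕ} (y : Fin d → ℤ) (i : Fin d) :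
    latAdj y (y + Pi.single i 1) := by
  unfold latAdj
  rw [Finset.sum_eq_single i] <;> simp +contextual

lemma piW_cS_ne_zero {d L : ℕ} (hd : 2 ≤ d) {y : Fin d → ℤ} (hy : memS L y) :
    piW (cS d L) y ≠ 0 := by
  intro h
  have := ENNReal.tsum_eq_zero.1 h (y + Pi.single ⟨1, hd⟩ 1)
  have hm : memS L (y + Pi.single ⟨1, hd⟩ 1) := fun i hi => by
    have hne : i ≠ ⟨1, hd⟩ := by rintro rfl; simp at hi
    simpa [hne] using hy i hi
  simp [cS, hy, hm, latAdj_add_single] at this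

lemma cS_le_cZ (d L : ℕ) (x y : Fin d → ℤ) : cS d L x y ≤ cZ d x y := by
  unfold cS cZ
  split_ifs <;> simp_all

lemma piW_cS_le (d L : ℕ) (y : Fin d → ℤ) : piW (cS d L) y ≤ piW (cZ d) y :=
  ENNReal.tsum_le_tsum fun z => cS_le_cZ d L y z

lemma piW_cZ_ne_top (d : ℕ) (y : Fin d → ℤ) : piW (cZ d) y ≠ ∞ := by
  unfold piW
  rw [tsum_eq_sum (s := Finset.Icc (y - 1) (y + 1))]
  · refine ENNReal.sum_ne_top.2 fun z _ => ?_
    unfold cZ; split_ifs <;> simp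
  · intro z hz
    have : ¬ latAdj y z := fun h => hz <| by
      have hi (i : Fin d) : (y i - z i).natAbs ≤ 1 := by
        rw [← h]
        exact Finset.single_le_sum (f := fun i => (y i - z i).natAbs) (fun _ _ => Nat.zero_le _)
          (Finset.mem_univ i)
      rw [Finset.mem_Icc]
      constructor <;> intro i <;> have := hi i <;> simp <;> omega
    simp [cZ, this]

/-- Sum of `f` over the orbit of `y` under the reflection group of the strip. -/
def periodize {d : ℕ} (L : ℕ) (f : (Fin d → ℤ) → ℝ≥0∞) (y : Fin d → ℤ) : ℝ≥0∞ :=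
  ∑' k : ℤ, f (stripImage L k y)

/-- The involution of `ℤ` moving even integers down by one and odd ones up by one. -/
def parityFlip : Equiv.Perm ℤ where
  toFun k := if k % 2 = 0 then k - 1 else k + 1
  invFun k := if k % 2 = 0 then k - 1 else k + 1
  left_inv k := by dsimp only; split_ifs <;> omega
  right_inv k := by dsimp only; split_ifs <;> omega

/-- The involution of `ℤ` moving even integers up by one and odd ones down by one. -/
def parityFlip' : Equiv.Perm ℤ where
  toFun k := if k % 2 = 0 then k + 1 else k - 1
  invFun k := if k % 2 = 0 then k + 1 else k - 1
  left_inv k := by dsimp only; split_ifs <;> omega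
  right_inv k := by dsimp only; split_ifs <;> omega

lemma periodize_stripImage_neg_one {d : ℕ} (L : ℕ) (f : (Fin d → ℤ) → ℝ≥0∞) (y : Fin d → ℤ) :
    periodize L f (stripImage L (-1) y) = periodize L f y := by
  unfold periodize
  rw [← parityFlip.tsum_eq fun k => f (stripImage L k y)]
  refine tsum_congr fun k => congrArg f ?_
  ext i
  simp only [stripImage_apply, parityFlip, Equiv.coe_fn_mk]
  split_ifs <;> first | omega | ring

lemma periodize_stripImage_one {d : ℕ} (L : ℕ) (f : (Fin d → ℤ) → ℝ≥0∞) (y : Fin d → ℤ) :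
    periodize L f (stripImage L 1 y) = periodize L f y := by
  unfold periodize
  rw [← parityFlip'.tsum_eq fun k => f (stripImage L k y)]
  refine tsum_congr fun k => congrArg f ?_
  ext i
  simp only [stripImage_apply, parityFlip', Equiv.coe_fn_mk]
  split_ifs <;> first | omega | ring

lemma eq_stripImage_of_latAdj {d L : ℕ} {y z : Fin d → ℤ} (hy : memS L y) (hz : ¬ memS L z)
    (h : latAdj z y) : z = stripImage L (-1) y ∨ z = stripImage L 1 y := by
  simp only [memS, not_forall] at hz
  obtain ⟨i, hi, hzi⟩ := hz
  have hyi := hy i hi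
  unfold latAdj at h
  rw [← Finset.add_sum_erase _ _ (Finset.mem_univ i)] at h
  have hrest : ∑ j ∈ Finset.univ.erase i, (z j - y j).natAbs = 0 := by omega
  have hne (j : Fin d) (hj : (j : ℕ) ≠ 0) : z j = y j := by
    have hji : j ≠ i := by rintro rfl; exact hj hi
    have := Finset.sum_eq_zero_iff.1 hrest j (by simp [hji])
    omega
  have hval : z i = -1 - y i ∨ z i = 2 * L - 1 - y i := by omega
  refine hval.imp ?_ ?_ <;>
  · intro hv
    ext j
    rw [stripImage_apply]
    split_ifs with hj
    · omega
    · obtain rfl : j = i := Fin.ext (hj.trans hi.symm)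
      omega
    · exact hne j hj

lemma periodize_eq_of_latAdj {d L : ℕ} (f : (Fin d → ℤ) → ℝ≥0∞) {y z : Fin d → ℤ}
    (hy : memS L y) (hz : ¬ memS L z) (h : latAdj z y) : periodize L f z = periodize L f y := by
  obtain rfl | rfl := eq_stripImage_of_latAdj hy hz h
  · exact periodize_stripImage_neg_one L f y
  · exact periodize_stripImage_one L f y

/-- Number of neighbours of `y` outside the strip. -/
def outDegree (d L : ℕ) (y : Fin d → ℤ) : ℝ≥0∞ := ∑' z, if memS L z then 0 else cZ d z y

lemma tsum_mul_cZ {d L : ℕ} {F : (Fin d → ℤ) → ℝ≥0∞} {y : Fin d → ℤ} (hy : memS L y)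
    (hF : ∀ z, ¬ memS L z → latAdj z y → F z = F y) :
    ∑' z, F z * cZ d z y = ∑' z, F z * cS d L z y + outDegree d L y * F y := by
  rw [outDegree, ← ENNReal.tsum_mul_right, ← ENNReal.tsum_add]
  refine tsum_congr fun z => ?_
  by_cases hz : memS L z
  · simp [cZ, cS, hz, hy]
  · by_cases ha : latAdj z y
    · simp [cZ, cS, hz, ha, hF z hz ha]
    · simp [cZ, cS, ha]

lemma piW_cZ_eq_add {d L : ℕ} {y : Fin d → ℤ} (hy : memS L y) :
    piW (cZ d) y = piW (cS d L) y + outDegree d L y := by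
  simpa [piW, cZ_comm y, cS_comm y] using
    tsum_mul_cZ (F := fun _ => 1) hy (fun _ _ _ => rfl)

lemma tsum_delta_stripImage {d L : ℕ} (hd : 0 < d) {x y : Fin d → ℤ} (hx : memS L x)
    (hy : memS L y) :
    ∑' k : ℤ, (if x = stripImage L k y then (1 : ℝ≥0∞) else 0) = if x = y then 1 else 0 := by
  rw [tsum_eq_single 0, stripImage_zero]
  intro k hk
  rw [if_neg]
  rintro rfl
  have h1 := hx ⟨0, hd⟩ rfl
  have h2 := hy ⟨0, hd⟩ rfl
  rw [stripImage_apply] at h1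
  have key : k * L < L ∧ -L < k * L := by
    simp only [if_true] at h1
    split_ifs at h1 <;> omega
  have hL : (0 : ℤ) < L := by omega
  have h3 : k < 1 := by nlinarith
  have h4 : -1 < k := by nlinarith
  omega

lemma tsum_stripImage_mul_cZ {d L : ℕ} (f : (Fin d → ℤ) → ℝ≥0∞) (y : Fin d → ℤ) :
    ∑' k : ℤ, ∑' z, f z * cZ d z (stripImage L k y) = ∑' z, periodize L f z * cZ d z y := by
  simp only [periodize, ← ENNReal.tsum_mul_right]
  rw [ENNReal.tsum_comm (α := Fin d → ℤ)]
  refine tsum_congr fun k => ?_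
  rw [← (stripImageEquiv L k).tsum_eq]
  exact tsum_congr fun z => congrArg _ (cZ_stripImage L k z y)

lemma piW_mul_periodize {d L : ℕ} (hd : 0 < d) {x y : Fin d → ℤ} (hx : memS L x) (hy : memS L y)
    {f f' : (Fin d → ℤ) → ℝ≥0∞}
    (h : ∀ y, piW (cZ d) y * f' y = (if x = y then 1 else 0) + ∑' z, f z * cZ d z y) :
    (piW (cS d L) y + outDegree d L y) * periodize L f' y =
      (if x = y then 1 else 0) + ∑' z, periodize L f z * cS d L z y
        + outDegree d L y * periodize L f y := by
  rw [← piW_cZ_eq_add hy, add_assoc,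
    ← tsum_mul_cZ (F := periodize L f) hy fun z hz ha => periodize_eq_of_latAdj f hy hz ha,
    ← tsum_stripImage_mul_cZ, ← tsum_delta_stripImage hd hx hy, ← ENNReal.tsum_add]
  rw [periodize, ← ENNReal.tsum_mul_left]
  refine tsum_congr fun k => ?_
  rw [← h, piW_cZ_stripImage]

/-- **Green's function for the strip.** For `d ≥ 4`, `L ≥ 2` and `x, y` in the strip
`S_L = [0,L-1] × ℤ^{d-1}`,
`G_{S_L}(x,y) = Σ_{k ∈ ℤ} [ g(x, (kL+L-1)e₁ + ȳ)·1{k odd} + g(x, kL e₁ + y)·1{k even} ]`. -/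
theorem green_strip (d : ℕ) (hd : 4 ≤ d) (L : ℕ) (hL : 2 ≤ L) (x y : Fin d → ℤ)
    (hx : memS L x) (hy : memS L y) :
    GS d L x y = ∑' k : ℤ,
      (if k % 2 = 0 then g d x ((k * (L : ℤ)) • e1 d + y)
       else g d x ((k * (L : ℤ) + (L : ℤ) - 1) • e1 d + reflFirst y)) := by
  have hd0 : 0 < d := by omega
  have hS0 (z : Fin d → ℤ) (hz : memS L z) : piW (cS d L) z ≠ 0 :=
    piW_cS_ne_zero (by omega) hz
  have hS1 (z : Fin d → ℤ) : piW (cS d L) z ≠ ∞ :=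
    ne_top_of_le_ne_top (piW_cZ_ne_top d z) (piW_cS_le d L z)
  have hZ0 (z : Fin d → ℤ) : piW (cZ d) z ≠ 0 := fun h => by
    have := ENNReal.tsum_eq_zero.1 h (z + Pi.single ⟨0, hd0⟩ 1)
    simp [cZ, latAdj_add_single] at this
  have hcS (z w : Fin d → ℤ) (h : cS d L z w ≠ 0) : memS L z := by
    by_contra hz
    simp [cS, hz] at h
  have hout (z : Fin d → ℤ) (hz : memS L z) : outDegree d L z ≠ ∞ :=
    ne_top_of_le_ne_top (piW_cZ_ne_top d z) (by rw [piW_cZ_eq_add hz]; exact le_add_self)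
  trans periodize L (green (cZ d) x) y
  · apply le_antisymm
    · refine green_le_of_supersolution (A := memS L) (fun z w _ h => hcS z w h) hS0
        (fun z _ => hS1 z) (fun w hw => ?_) hy
      by_cases htop : periodize L (green (cZ d) x) w = ∞
      · simp [htop, ENNReal.mul_top (hS0 w hw)]
      · have := piW_mul_periodize hd0 hx hw fun z =>
          piW_mul_green (cZ d) x z (hZ0 z) (piW_cZ_ne_top d z)
        rw [add_mul] at this
        exact ((ENNReal.add_left_inj (ENNReal.mul_ne_top (hout w hw) htop)).1 this).ge
    · have htrunc (N : ℕ) : ∀ w, memS L w →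
          periodize L (truncGreen (cZ d) N x) w ≤ green (cS d L) x w := by
        induction N with
        | zero => simp [periodize]
        | succ N ih =>
          intro w hw
          rw [← ENNReal.mul_le_mul_iff_right (hZ0 w) (piW_cZ_ne_top d w), piW_cZ_eq_add hw,
            piW_mul_periodize hd0 hx hw fun z =>
              piW_mul_truncGreen_succ (cZ d) N x z (hZ0 z) (piW_cZ_ne_top d z),
            add_mul, piW_mul_green (cS d L) x w (hS0 w hw) (hS1 w)]
          refine add_le_add (add_le_add le_rfl (ENNReal.tsum_le_tsum fun z => ?_)) ?_
          · by_cases hz : cS d L z w = 0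
            · simp [hz]
            · gcongr
              exact ih z (hcS z w hz)
          · gcongr
            exact ih w hw
      simp only [periodize, green, ← ENNReal.tsum_mul_left]
      rw [ENNReal.tsum_comm]
      refine ENNReal.tsum_le_of_sum_range_le fun N => ?_
      rw [← Summable.tsum_finsetSum fun _ _ => ENNReal.summable]
      simpa only [← Finset.mul_sum, periodize, truncGreen, GS] using htrunc N y hy
  · exact tsum_congr fun k => by
      unfold stripImage g
      split_ifs <;> rfl

end
end
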